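/- For every a ∈ A_{2n} and all integers s, k, l with 1 ≤ k ≤ s and 1 ≤ l ≤ s, the element l·[a·ω^{s−k}, ω^k] − k·[a·ω^{s−l}, ω^l] lies in L_4(A_{2n}). -/

import Mathlib

noncomputable section

/-- Lower central series: `lcs A 1 = A`, `lcs A (k+1) = [A, lcs A k]` (ℂ-linear span). -/
def lcs (A : Type) [Ring A] [Algebra ℂ A] : ℕ → Submodule ℂ A
  | 0 => ⊤
  | 1 => ⊤
  | (k+2) => Submodule.span ℂ {x | ∃ a : A, ∃ b ∈ lcs A (k+1), x = a * b - b * a}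

/-- The free algebra on `2n` generators. -/
abbrev FA (n : ℕ) : Type := FreeAlgebra ℂ (Fin (2*n))

/-- The generator `x_j` (1-based indexing, junk value `0` out of range). -/
def X (n : ℕ) (j : ℕ) : FA n :=
  if h : 1 ≤ j ∧ j ≤ 2*n then FreeAlgebra.ι ℂ (⟨j-1, by omega⟩ : Fin (2*n)) else 0

/-- `ω = (1/2) ∑ᵢ [xᵢ, xᵢ₊ₙ]`. -/
def omg (n : ℕ) : FA n :=
  (1/2 : ℂ) • ∑ i ∈ Finset.Icc 1 n, (X n i * X n (i+n) - X n (i+n) * X n i)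


theorem commutator_mem_lcs {A : Type} [Ring A] [Algebra ℂ A] {k : ℕ} (a : A) {b : A}
    (hb : b ∈ lcs A (k + 1)) : a * b - b * a ∈ lcs A (k + 2) := by
  rw [lcs]
  exact Submodule.subset_span ⟨a, b, hb, rfl⟩

theorem omg_mem_lcs_two (n : ℕ) : omg n ∈ lcs (FA n) 2 := by
  refine Submodule.smul_mem _ _ (Submodule.sum_mem _ fun i _ => ?_)
  exact commutator_mem_lcs _ (by simp [lcs])

theorem double_commutator_mem_lcs_four {A : Type} [Ring A] [Algebra ℂ A] {w : A}
    (hw : w ∈ lcs A 2) (c : A) : w * w * c - 2 • (w * c * w) + c * w * w ∈ lcs A 4 := by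
  have h := (lcs A 4).neg_mem (commutator_mem_lcs w (commutator_mem_lcs c hw))
  convert h using 1
  noncomm_ring

/-- Modulo `L₄`, the element `w ^ k * a * w ^ (s - k)` is affine in `k`. -/
theorem pow_mul_mul_pow_affine_mod_lcs_four {A : Type} [Ring A] [Algebra ℂ A] {w : A}
    (hw : w ∈ lcs A 2) (a : A) (s k : ℕ) (hk : k ≤ s) :
    w ^ k * a * w ^ (s - k) - a * w ^ s - (k : ℂ) • (w * a * w ^ (s - 1) - a * w ^ s)
      ∈ lcs A 4 := by
  induction k using Nat.twoStepInduction with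
  | zero => simp
  | one => simp
  | more k ih₀ ih₁ =>
    obtain ⟨m, rfl⟩ := Nat.exists_eq_add_of_le hk
    have h := double_commutator_mem_lcs_four hw (w ^ k * a * w ^ m)
    have h₀ := ih₀ (by omega)
    have h₁ := ih₁ (by omega)
    have e₀ : k + 2 + m - k = m + 2 := by omega
    have e₁ : k + 2 + m - (k + 1) = m + 1 := by omega
    have e₂ : k + 2 + m - (k + 2) = m := by omega
    rw [e₀] at h₀
    rw [e₁] at h₁
    rw [e₂]
    have t₀ : w ^ k * a * w ^ m * w * w = w ^ k * a * w ^ (m + 2) := by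
      simp only [pow_succ, mul_assoc]
    have t₁ : w * (w ^ k * a * w ^ m) * w = w ^ (k + 1) * a * w ^ (m + 1) := by
      rw [pow_succ' w k, pow_succ w m]; simp only [mul_assoc]
    have t₂ : w * w * (w ^ k * a * w ^ m) = w ^ (k + 2) * a * w ^ m := by
      rw [pow_succ' w (k + 1), pow_succ' w k]; simp only [mul_assoc]
    rw [t₀, t₁, t₂] at h
    convert (lcs A 4).sub_mem ((lcs A 4).add_mem h ((lcs A 4).smul_mem (2 : ℂ) h₁)) h₀ using 1
    push_cast
    module

/-- For every `a ∈ A_{2n}` and all `1 ≤ k ≤ s`, `1 ≤ l ≤ s`,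
`l·[a·ω^{s−k}, ω^k] − k·[a·ω^{s−l}, ω^l] ∈ L₄(A_{2n})`. -/
theorem stmt4 (n : ℕ) (hn : 1 ≤ n) (a : FA n) (s k l : ℕ)
    (hk1 : 1 ≤ k) (hks : k ≤ s) (hl1 : 1 ≤ l) (hls : l ≤ s) :
    (l : ℂ) • ((a * (omg n)^(s-k)) * (omg n)^k - (omg n)^k * (a * (omg n)^(s-k)))
      - (k : ℂ) • ((a * (omg n)^(s-l)) * (omg n)^l - (omg n)^l * (a * (omg n)^(s-l)))
    ∈ lcs (FA n) 4 := by
  have affine := pow_mul_mul_pow_affine_mod_lcs_four (omg_mem_lcs_two n) a s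
  convert (lcs (FA n) 4).sub_mem ((lcs (FA n) 4).smul_mem (k : ℂ) (affine l hls))
    ((lcs (FA n) 4).smul_mem (l : ℂ) (affine k hks)) using 1
  simp only [mul_assoc, ← pow_add, Nat.sub_add_cancel hks, Nat.sub_add_cancel hls]
  module
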